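/- Evolution of the residual Gram matrix: along any solution of the continuous-time EnKF flow with y = A u†, the symmetric J×J matrix R(t) with entries R(t)_{lj} = ⟨A r^{(l)}(t), A r^{(j)}(t)⟩_Γ satisfies dR/dt = −(2/J) F Fᵀ, and consequently d/dt Tr(R(t)) = −(2/J)‖F(t)‖_Fr², where ‖·‖_Fr denotes the Frobenius norm and F(t)_{lj} = ⟨A r^{(l)}(t), A e^{(j)}(t)⟩_Γ. -/

import Mathlib

open scoped BigOperators
open RealInnerProductSpace Matrix

noncomputable section

/-- The Γ-weighted inner product `⟨a,b⟩_Γ = ⟨Γ⁻¹ a, b⟩` on `ℝ^K`. -/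
def gInner {K : ℕ} (Γ : Matrix (Fin K) (Fin K) ℝ)
    (a b : EuclideanSpace ℝ (Fin K)) : ℝ :=
  ⟪Matrix.toEuclideanLin Γ⁻¹ a, b⟫

/-- Ensemble mean. -/
def ensMean {X : Type*} [AddCommGroup X] [Module ℝ X] {J : ℕ} (v : Fin J → X) : X :=
  (J : ℝ)⁻¹ • ∑ j, v j

/-- Right-hand side of the continuous-time EnKF flow. -/
def enkfRHS {X : Type*} [NormedAddCommGroup X] [InnerProductSpace ℝ X] {K J : ℕ}
    (A : X →L[ℝ] EuclideanSpace ℝ (Fin K)) (Γ : Matrix (Fin K) (Fin K) ℝ)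
    (y : EuclideanSpace ℝ (Fin K)) (v : Fin J → X) (j : Fin J) : X :=
  (J : ℝ)⁻¹ • ∑ k, gInner Γ (A (v k - ensMean v)) (y - A (v j)) • (v k - ensMean v)

/-- `u : ℝ → Fin J → X` solves the continuous-time EnKF flow on `[0,∞)`. -/
def IsEnKFSolution {X : Type*} [NormedAddCommGroup X] [InnerProductSpace ℝ X] {K J : ℕ}
    (A : X →L[ℝ] EuclideanSpace ℝ (Fin K)) (Γ : Matrix (Fin K) (Fin K) ℝ)
    (y : EuclideanSpace ℝ (Fin K)) (u : ℝ → Fin J → X) : Prop :=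
  ∀ j : Fin J, ∀ t ∈ Set.Ici (0 : ℝ),
    HasDerivWithinAt (fun s => u s j) (enkfRHS A Γ y (u t) j) (Set.Ici 0) t

/-- The deviation Gram matrix `E` of an ensemble. -/
def matE {X : Type*} [NormedAddCommGroup X] [InnerProductSpace ℝ X] {K J : ℕ}
    (A : X →L[ℝ] EuclideanSpace ℝ (Fin K)) (Γ : Matrix (Fin K) (Fin K) ℝ)
    (v : Fin J → X) : Matrix (Fin J) (Fin J) ℝ :=
  Matrix.of fun l j => gInner Γ (A (v l - ensMean v)) (A (v j - ensMean v))

/-- The residual/deviation cross Gram matrix `F` of an ensemble. -/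
def matF {X : Type*} [NormedAddCommGroup X] [InnerProductSpace ℝ X] {K J : ℕ}
    (A : X →L[ℝ] EuclideanSpace ℝ (Fin K)) (Γ : Matrix (Fin K) (Fin K) ℝ)
    (udag : X) (v : Fin J → X) : Matrix (Fin J) (Fin J) ℝ :=
  Matrix.of fun l j => gInner Γ (A (v l - udag)) (A (v j - ensMean v))

/-- The residual Gram matrix `R` of an ensemble. -/
def matR {X : Type*} [NormedAddCommGroup X] [InnerProductSpace ℝ X] {K J : ℕ}
    (A : X →L[ℝ] EuclideanSpace ℝ (Fin K)) (Γ : Matrix (Fin K) (Fin K) ℝ)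
    (udag : X) (v : Fin J → X) : Matrix (Fin J) (Fin J) ℝ :=
  Matrix.of fun l j => gInner Γ (A (v l - udag)) (A (v j - udag))

/-- The orthogonal complement of a subspace of `ℝ^K` w.r.t. the Γ-weighted inner product. -/
def gOrth {K : ℕ} (Γ : Matrix (Fin K) (Fin K) ℝ)
    (S : Submodule ℝ (EuclideanSpace ℝ (Fin K))) :
    Submodule ℝ (EuclideanSpace ℝ (Fin K)) where
  carrier := {w | ∀ v ∈ S, gInner Γ v w = 0}
  add_mem' := by
    intro a b ha hb v hv
    have h1 := ha v hv
    have h2 := hb v hv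
    simp only [gInner, Set.mem_setOf_eq] at *
    rw [inner_add_right, h1, h2, add_zero]
  zero_mem' := by
    intro v hv
    simp [gInner]
  smul_mem' := by
    intro c a ha v hv
    have h1 := ha v hv
    simp only [gInner, Set.mem_setOf_eq] at *
    rw [inner_smul_right, h1, mul_zero]

/-- The orthogonal complement of a subspace of `X` w.r.t. the inner product
`⟨v,w⟩_* = ⟨A v, A w⟩_Γ`. -/
def gOrthX {X : Type*} [NormedAddCommGroup X] [InnerProductSpace ℝ X] {K : ℕ}
    (A : X →L[ℝ] EuclideanSpace ℝ (Fin K)) (Γ : Matrix (Fin K) (Fin K) ℝ)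
    (S : Submodule ℝ X) : Submodule ℝ X where
  carrier := {w | ∀ v ∈ S, gInner Γ (A v) (A w) = 0}
  add_mem' := by
    intro a b ha hb v hv
    have h1 := ha v hv
    have h2 := hb v hv
    simp only [gInner, Set.mem_setOf_eq, map_add] at *
    rw [inner_add_right, h1, h2, add_zero]
  zero_mem' := by
    intro v hv
    simp [gInner]
  smul_mem' := by
    intro c a ha v hv
    have h1 := ha v hv
    simp only [gInner, Set.mem_setOf_eq, _root_.map_smul] at *
    rw [inner_smul_right, h1, mul_zero]


theorem gInner_symm' {K : ℕ} {Γ : Matrix (Fin K) (Fin K) ℝ} (hΓ : Γ.PosDef)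
    (a b : EuclideanSpace ℝ (Fin K)) : gInner Γ a b = gInner Γ b a := by
  have h : (Matrix.toEuclideanLin Γ⁻¹).IsSymmetric :=
    Matrix.isSymmetric_toEuclideanLin_iff.mpr hΓ.inv.isHermitian
  unfold gInner
  rw [h a b, real_inner_comm]

theorem gInner_rhs {X : Type*} [NormedAddCommGroup X] [InnerProductSpace ℝ X]
    {K J : ℕ} (A : X →L[ℝ] EuclideanSpace ℝ (Fin K))
    (Γ : Matrix (Fin K) (Fin K) ℝ) (hΓ : Γ.PosDef)
    (udag : X) (v : Fin J → X) (l j : Fin J) :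
    gInner Γ (A (v l - udag)) (A (enkfRHS A Γ (A udag) v j)) =
      -(1 / (J : ℝ)) * (matF A Γ udag v * (matF A Γ udag v)ᵀ) l j := by
  have hk : ∀ k, gInner Γ (A (v k - ensMean v)) (A udag - A (v j)) =
      - matF A Γ udag v j k := by
    intro k
    rw [matF, Matrix.of_apply, gInner_symm' hΓ (A (v j - udag)), ← neg_sub (A (v j)), ← map_sub]
    simp only [gInner, inner_neg_right]
  unfold enkfRHS
  simp only [hk, map_smul, map_sum, Matrix.mul_apply, Matrix.transpose_apply]
  conv_lhs => unfold gInner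
  simp only [inner_smul_right, inner_sum, Finset.mul_sum]
  refine Finset.sum_congr rfl fun k _ => ?_
  simp only [matF, Matrix.of_apply, gInner]
  ring

theorem enkf_residual_gram_evolution
    {X : Type*} [NormedAddCommGroup X] [InnerProductSpace ℝ X]
    {K J : ℕ} (hJ : 0 < J)
    (A : X →L[ℝ] EuclideanSpace ℝ (Fin K))
    (Γ : Matrix (Fin K) (Fin K) ℝ) (hΓ : Γ.PosDef)
    (udag : X) (u : ℝ → Fin J → X)
    (hu : IsEnKFSolution A Γ (A udag) u) :
    (∀ t ∈ Set.Ici (0 : ℝ), ∀ l j : Fin J,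
      HasDerivWithinAt (fun s => matR A Γ udag (u s) l j)
        ((-(2 / (J : ℝ))) * (matF A Γ udag (u t) * (matF A Γ udag (u t))ᵀ) l j)
        (Set.Ici 0) t) ∧
    ∀ t ∈ Set.Ici (0 : ℝ),
      HasDerivWithinAt (fun s => (matR A Γ udag (u s)).trace)
        ((-(2 / (J : ℝ))) * ∑ i, ∑ j, (matF A Γ udag (u t) i j) ^ 2)
        (Set.Ici 0) t := by
  have main : ∀ t ∈ Set.Ici (0 : ℝ), ∀ l j : Fin J,
      HasDerivWithinAt (fun s => matR A Γ udag (u s) l j)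
        ((-(2 / (J : ℝ))) * (matF A Γ udag (u t) * (matF A Γ udag (u t))ᵀ) l j)
        (Set.Ici 0) t := by
    intro t ht l j
    have hd : ∀ i, HasDerivWithinAt (fun s => A (u s i - udag))
        (A (enkfRHS A Γ (A udag) (u t) i)) (Set.Ici 0) t := fun i =>
      A.hasFDerivAt.comp_hasDerivWithinAt t ((hu i t ht).sub_const udag)
    have hB : HasDerivWithinAt
        (fun s => (Matrix.toEuclideanLin Γ⁻¹) (A (u s l - udag)))
        ((Matrix.toEuclideanLin Γ⁻¹) (A (enkfRHS A Γ (A udag) (u t) l))) (Set.Ici 0) t :=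
      (LinearMap.toContinuousLinearMap (Matrix.toEuclideanLin Γ⁻¹)).hasFDerivAt.comp_hasDerivWithinAt
        t (hd l)
    have h := hB.inner ℝ (hd j)
    refine h.congr_deriv ?_
    change gInner Γ (A (u t l - udag)) (A (enkfRHS A Γ (A udag) (u t) j)) +
      gInner Γ (A (enkfRHS A Γ (A udag) (u t) l)) (A (u t j - udag)) = _
    rw [gInner_symm' hΓ (A (enkfRHS A Γ (A udag) (u t) l)), gInner_rhs A Γ hΓ,
      gInner_rhs A Γ hΓ]
    have hs : (matF A Γ udag (u t) * (matF A Γ udag (u t))ᵀ) j l =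
        (matF A Γ udag (u t) * (matF A Γ udag (u t))ᵀ) l j := by
      simp only [Matrix.mul_apply, Matrix.transpose_apply, mul_comm]
    rw [hs]
    ring
  refine ⟨main, fun t ht => ?_⟩
  have h := HasDerivWithinAt.fun_sum (u := Finset.univ) fun i _ => main t ht i i
  refine h.congr_deriv ?_
  simp only [Matrix.mul_apply, Matrix.transpose_apply, Finset.mul_sum, sq]

end
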